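/- arXiv:q-alg/9506015 — 14 statements merged into one kernel-verified Lean document; each statement's English description precedes it below -/
import Mathlib

section
/- Let I be a finite type with a parity function p : I → ℤ/2, and let R : (I×I) × (I×I) → ℂ, with entries written R^a_c^b_d for the value at row (a,b), column (c,d). Assume (i) R satisfies the quantum Yang–Baxter equation: for all i,j,a,b,c,d ∈ I, ∑_{e,f,k} R^b_e^a_f · R^i_k^f_c · R^k_j^e_d = ∑_{p',r,s} R^i_{p'}^b_r · R^{p'}_j^a_s · R^r_d^s_c; and (ii) R is superizable (null-degree condition): R^a_c^b_d = 0 whenever p(a)+p(b) ≠ p(c)+p(d) in ℤ/2. Define R̄^a_c^b_d = (−1)^{p(a)p(b)} R^a_c^b_d, where (−1)^x means 1 if x = 0 and −1 if x = 1 in ℤ/2. Then R̄ satisfies the super Yang–Baxter equation: for all i,j,a,b,c,d ∈ I, ∑_{e,f,k} (−1)^{p(e)(p(f)+p(c))} R̄^b_e^a_f · R̄^i_k^f_c · R̄^k_j^e_d = ∑_{p',r,s} (−1)^{p(r)(p(s)+p(a))} R̄^i_{p'}^b_r · R̄^{p'}_j^a_s · R̄^r_d^s_c. -/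
open BigOperators

/-- `msign x` is `(−1)^x` for `x : ZMod 2`: `1` if `x = 0` and `−1` if `x = 1`. -/
def msign (x : ZMod 2) : ℂ := if x = 0 then 1 else -1

/-- The superization `R̄^a_c^b_d = (−1)^{p(a)p(b)} R^a_c^b_d` of a matrix `R`. -/
def superize {I : Type*} (par : I → ZMod 2) (R : I → I → I → I → ℂ) :
    I → I → I → I → ℂ :=
  fun a c b d => msign (par a * par b) * R a c b d

theorem msign_add (x y : ZMod 2) : msign (x + y) = msign x * msign y := by
  have h : ∀ x y : ZMod 2, (x = 0 ∧ y = 0 ∧ x + y = 0) ∨ (x = 0 ∧ y ≠ 0 ∧ x + y ≠ 0) ∨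
      (x ≠ 0 ∧ y = 0 ∧ x + y ≠ 0) ∨ (x ≠ 0 ∧ y ≠ 0 ∧ x + y = 0) := by decide
  rcases h x y with ⟨h1, h2, h3⟩ | ⟨h1, h2, h3⟩ | ⟨h1, h2, h3⟩ | ⟨h1, h2, h3⟩ <;>
    simp only [msign, h3, if_true, if_false] <;> simp [h1, h2]

theorem left_exponent_eq : ∀ a b c e f i k : ZMod 2, a + b = e + f → i + f = k + c →
    e * (f + c) + (a * b + i * f + k * e) = i * a + i * b + a * b := by
  intro a b c e f i k h1 h2
  linear_combination (-i) * h1 - e * h2 + e * f * CharTwo.two_eq_zero (R := ZMod 2)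

theorem right_exponent_eq : ∀ a b i q r s : ZMod 2, i + b = q + r →
    r * (s + a) + (i * b + q * a + r * s) = i * a + i * b + a * b := by
  intro a b i q r s h
  linear_combination (-a) * h + (r * s) * CharTwo.two_eq_zero (R := ZMod 2)

theorem left_term_eq {I : Type*} (par : I → ZMod 2) (R : I → I → I → I → ℂ)
    (hnull : ∀ a c b d : I, par a + par b ≠ par c + par d → R a c b d = 0)
    (i j a b c d e f k : I) :
    msign (par e * (par f + par c)) *
        (superize par R b e a f * superize par R i k f c * superize par R k j e d) =
      msign (par i * par a + par i * par b + par a * par b) *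
        (R b e a f * R i k f c * R k j e d) := by
  by_cases h1 : par b + par a = par e + par f
  · by_cases h2 : par i + par f = par k + par c
    · rw [← left_exponent_eq _ _ _ _ _ _ _ ((add_comm _ _).trans h1) h2]
      simp only [superize, msign_add, mul_comm (par b) (par a)]
      ring
    · simp [superize, hnull _ _ _ _ h2]
  · simp [superize, hnull _ _ _ _ h1]

theorem right_term_eq {I : Type*} (par : I → ZMod 2) (R : I → I → I → I → ℂ)
    (hnull : ∀ a c b d : I, par a + par b ≠ par c + par d → R a c b d = 0)
    (i j a b c d q r s : I) :
    msign (par r * (par s + par a)) *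
        (superize par R i q b r * superize par R q j a s * superize par R r d s c) =
      msign (par i * par a + par i * par b + par a * par b) *
        (R i q b r * R q j a s * R r d s c) := by
  by_cases h : par i + par b = par q + par r
  · rw [← right_exponent_eq _ _ _ _ _ (par s) h]
    simp only [superize, msign_add]
    ring
  · simp [superize, hnull _ _ _ _ h]

/-- A superizable solution of the quantum Yang–Baxter equation gives, after
superization, a solution of the super Yang–Baxter equation. -/
theorem superize_sybe {I : Type*} [Fintype I] (par : I → ZMod 2)
    (R : I → I → I → I → ℂ)
    (hQYBE : ∀ i j a b c d : I,
      ∑ e, ∑ f, ∑ k, R b e a f * R i k f c * R k j e d =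
        ∑ p', ∑ r, ∑ s, R i p' b r * R p' j a s * R r d s c)
    (hnull : ∀ a c b d : I, par a + par b ≠ par c + par d → R a c b d = 0)
    (i j a b c d : I) :
    ∑ e, ∑ f, ∑ k, msign (par e * (par f + par c)) *
        (superize par R b e a f * superize par R i k f c * superize par R k j e d) =
      ∑ p', ∑ r, ∑ s, msign (par r * (par s + par a)) *
        (superize par R i p' b r * superize par R p' j a s * superize par R r d s c) := by
  simp only [left_term_eq par R hnull, right_term_eq par R hnull, ← Finset.mul_sum, hQYBE]
end

section
/- Let q be a nonzero complex number and put the parity p(1) = 0, p(2) = 1 on {1,2}. Then the superized Alexander–Conway matrix R̄(q) = [[q,0,0,0],[0,1,q−q⁻¹,0],[0,0,1,0],[0,0,0,q⁻¹]] (rows/columns indexed by pairs ordered (1,1),(1,2),(2,1),(2,2), entry in row (a,b), column (c,d) written R̄^a_c^b_d) satisfies the super Yang–Baxter equation: for all i,j,a,b,c,d ∈ {1,2}, ∑_{e,f,k} (−1)^{p(e)(p(f)+p(c))} R̄^b_e^a_f · R̄^i_k^f_c · R̄^k_j^e_d = ∑_{p',r,s} (−1)^{p(r)(p(s)+p(a))}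 R̄^i_{p'}^b_r · R̄^{p'}_j^a_s · R̄^r_d^s_c. -/
open BigOperators

/-- The parity `p(1) = 0`, `p(2) = 1` on `{1,2}` (indexed here by `Fin 2`). -/
def par2 (i : Fin 2) : ZMod 2 := (i.val : ZMod 2)

/-- The superized Alexander–Conway R-matrix: `RbarAC q a c b d` is the entry
`R̄^a_c^b_d` (row `(a,b)`, column `(c,d)`), indices `0,1` playing the roles of `1,2`. -/
noncomputable def RbarAC (q : ℂ) : Fin 2 → Fin 2 → Fin 2 → Fin 2 → ℂ
  | 0, 0, 0, 0 => q
  | 0, 0, 1, 1 => 1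
  | 0, 1, 1, 0 => q - q⁻¹
  | 1, 1, 0, 0 => 1
  | 1, 1, 1, 1 => q⁻¹
  | _, _, _, _ => 0

/-- The sign `(−1)^{p(e)(p(f)+p(c))}` is `−1` exactly when `e` is odd and `f ≠ c`. -/
lemma msign_par2_mul_add (e f c : Fin 2) :
    msign (par2 e * (par2 f + par2 c)) = if e = 1 ∧ f ≠ c then -1 else 1 := by
  have h : par2 e * (par2 f + par2 c) = 0 ↔ ¬(e = 1 ∧ f ≠ c) := by
    revert e f c
    unfold par2
    decide
  simp only [msign, h, ite_not]

/-- The entries of the superized Alexander–Conway R-matrix as a single conditional expression. -/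
lemma RbarAC_eq_ite (q : ℂ) (a c b d : Fin 2) :
    RbarAC q a c b d =
      if a = c ∧ b = d then (if a = b then (if a = 0 then q else q⁻¹) else 1)
      else if a = 0 ∧ c = 1 ∧ b = 1 ∧ d = 0 then q - q⁻¹ else 0 := by
  revert a c b d
  simp [Fin.forall_fin_two, RbarAC]

/-- The superized Alexander–Conway matrix satisfies the super Yang–Baxter equation. -/
theorem RbarAC_sybe (q : ℂ) (hq : q ≠ 0) (i j a b c d : Fin 2) :
    ∑ e, ∑ f, ∑ k, msign (par2 e * (par2 f + par2 c)) *
        (RbarAC q b e a f * RbarAC q i k f c * RbarAC q k j e d) =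
      ∑ p', ∑ r, ∑ s, msign (par2 r * (par2 s + par2 a)) *
        (RbarAC q i p' b r * RbarAC q p' j a s * RbarAC q r d s c) := by
  have hqq : q * q⁻¹ = 1 := mul_inv_cancel₀ hq
  simp only [msign_par2_mul_add, RbarAC_eq_ite, Fin.sum_univ_two]
  revert i j a b c d
  simp only [Fin.forall_fin_two, Fin.isValue, ne_eq, zero_ne_one, one_ne_zero, not_true_eq_false,
    not_false_eq_true, and_true, true_and, and_false, false_and, and_self, if_true, if_false,
    mul_zero, zero_mul, mul_one, one_mul, add_zero, zero_add]
  repeat' apply And.intro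
  all_goals first | ring1 | linear_combination (q⁻¹ - q) * hqq
end

section
/- Let q, λ₁, λ₂ be nonzero complex numbers with q² ≠ 1. Define the 2×2 complex matrices K₁ = diag(λ₁, q⁻¹λ₁), K₂ = diag(λ₂, −qλ₂), X⁺ = [[0, (λ₁λ₂ − (λ₁λ₂)⁻¹)/(q − q⁻¹)],[0,0]], X⁻ = [[0,0],[1,0]]. Then these matrices satisfy all the defining relations of the non-standard quantum group U_q(K₁,K₂,X±): K₁ and K₂ are invertible and commute, K₁X± = q^{±1} X± K₁, K₂X± = −q^{∓1} X± K₂, X⁺X⁻ − X⁻X⁺ = (K₁K₂ − K₁⁻¹K₂⁻¹)/(q − q⁻¹), and (X⁺)² = (X⁻)² = 0. -/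
open Matrix

theorem inv_diag_fin_two {K : Type*} [Field K] {a b : K} (ha : a ≠ 0) (hb : b ≠ 0) :
    (!![a, 0; 0, b] : Matrix (Fin 2) (Fin 2) K)⁻¹ = !![a⁻¹, 0; 0, b⁻¹] :=
  Matrix.inv_eq_right_inv (by simp [Matrix.one_fin_two, ha, hb])

theorem isUnit_diag_fin_two {K : Type*} [Field K] {a b : K} (ha : a ≠ 0) (hb : b ≠ 0) :
    IsUnit (!![a, 0; 0, b] : Matrix (Fin 2) (Fin 2) K) := by
  simp [Matrix.isUnit_iff_isUnit_det, Matrix.det_fin_two_of, ha, hb]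

/-- The two-dimensional representation matrices of `U_q(K₁,K₂,X±)` with labels
`(λ₁,λ₂)` satisfy all the defining relations of the non-standard quantum group. -/
theorem irrep_satisfies_relations (q l1 l2 : ℂ) (hq : q ≠ 0) (hl1 : l1 ≠ 0)
    (hl2 : l2 ≠ 0) (hq2 : q ^ 2 ≠ 1) :
    let K1 : Matrix (Fin 2) (Fin 2) ℂ := !![l1, 0; 0, q⁻¹ * l1]
    let K2 : Matrix (Fin 2) (Fin 2) ℂ := !![l2, 0; 0, -q * l2]
    let Xp : Matrix (Fin 2) (Fin 2) ℂ :=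
      !![0, (l1 * l2 - (l1 * l2)⁻¹) / (q - q⁻¹); 0, 0]
    let Xm : Matrix (Fin 2) (Fin 2) ℂ := !![0, 0; 1, 0]
    IsUnit K1 ∧ IsUnit K2 ∧ K1 * K2 = K2 * K1 ∧
      K1 * Xp = q • (Xp * K1) ∧ K1 * Xm = q⁻¹ • (Xm * K1) ∧
      K2 * Xp = (-q⁻¹) • (Xp * K2) ∧ K2 * Xm = (-q) • (Xm * K2) ∧
      Xp * Xm - Xm * Xp = (q - q⁻¹)⁻¹ • (K1 * K2 - K1⁻¹ * K2⁻¹) ∧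
      Xp * Xp = 0 ∧ Xm * Xm = 0 := by
  intro K1 K2 Xp Xm
  have ha : q⁻¹ * l1 ≠ 0 := mul_ne_zero (inv_ne_zero hq) hl1
  have hb : -q * l2 ≠ 0 := mul_ne_zero (neg_ne_zero.mpr hq) hl2
  have hK1 : K1⁻¹ = !![l1⁻¹, 0; 0, (q⁻¹ * l1)⁻¹] := inv_diag_fin_two hl1 ha
  have hK2 : K2⁻¹ = !![l2⁻¹, 0; 0, (-q * l2)⁻¹] := inv_diag_fin_two hl2 hb
  have hmul : K1 * K2 = !![l1 * l2, 0; 0, -(l1 * l2)] := by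
    ext i j
    fin_cases i <;> fin_cases j <;> simp [K1, K2]
    field_simp
  have hinv : K1⁻¹ * K2⁻¹ = !![(l1 * l2)⁻¹, 0; 0, -(l1 * l2)⁻¹] := by
    rw [hK1, hK2]
    ext i j
    fin_cases i <;> fin_cases j <;> simp <;> field_simp
  refine ⟨isUnit_diag_fin_two hl1 ha, isUnit_diag_fin_two hl2 hb, ?_, ?_, ?_, ?_, ?_, ?_, ?_, ?_⟩
  · simp [K1, K2, mul_comm]
  · ext i j
    fin_cases i <;> fin_cases j <;> simp [K1, Xp]
    field_simp
  · simp [K1, Xm]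
  · ext i j
    fin_cases i <;> fin_cases j <;> simp [K2, Xp]
    field_simp
  · simp [K2, Xm]
  · rw [hmul, hinv]
    ext i j
    fin_cases i <;> fin_cases j <;> simp [Xp, Xm] <;> ring
  · simp [Xp, ← Matrix.ext_iff]
  · simp [Xm, ← Matrix.ext_iff]
end

section
/- Let q, λ₁, λ₂, μ₁, μ₂ be nonzero complex numbers with q² ≠ 1 and (λ₁λ₂μ₁μ₂)² ≠ 1. For nonzero parameters (ν₁,ν₂), let π_{ν₁,ν₂} denote the 2-dimensional representation K₁ ↦ diag(ν₁, q⁻¹ν₁), K₂ ↦ diag(ν₂, −qν₂), X⁺ ↦ [[0,(ν₁ν₂ − (ν₁ν₂)⁻¹)/(q−q⁻¹)],[0,0]], X⁻ ↦ [[0,0],[1,0]]. Define the 4×4 matrices T(K₁) = π_{λ}(K₁) ⊗ π_{μ}(K₁), T(K₂) = π_{λ}(K₂) ⊗ π_{μ}(K₂), T(X⁺) = π_{λ}(X⁺) ⊗ π_{μ}(K₁) + π_{λ}(K₂)⁻¹ ⊗ π_{μ}(X⁺), T(X⁻) = π_{λ}(X⁻) ⊗ π_{μ}(K₂) + π_{λ}(K₁)⁻¹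 ⊗ π_{μ}(X⁻), where λ = (λ₁,λ₂), μ = (μ₁,μ₂) and ⊗ is the Kronecker product. Then there exists an invertible 4×4 complex matrix S such that for each generator g ∈ {K₁, K₂, X⁺, X⁻}, S · T(g) · S⁻¹ is the block-diagonal matrix with blocks π_{λ₁μ₁, λ₂μ₂}(g) and π_{q⁻¹λ₁μ₁, −qλ₂μ₂}(g); i.e. the tensor product decomposes as (λ₁,λ₂)⊗(μ₁,μ₂) = (λ₁μ₁,λ₂μ₂) ⊕ (q⁻¹λ₁μ₁,−qλ₂μ₂). -/
open Matrix Kronecker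

/-- `π_{ν₁,ν₂}(K₁)`. -/
noncomputable def piK1 (q n1 : ℂ) : Matrix (Fin 2) (Fin 2) ℂ := !![n1, 0; 0, q⁻¹ * n1]

/-- `π_{ν₁,ν₂}(K₂)`. -/
def piK2 (q n2 : ℂ) : Matrix (Fin 2) (Fin 2) ℂ := !![n2, 0; 0, -q * n2]

/-- `π_{ν₁,ν₂}(X⁺)`. -/
noncomputable def piXp (q n1 n2 : ℂ) : Matrix (Fin 2) (Fin 2) ℂ :=
  !![0, (n1 * n2 - (n1 * n2)⁻¹) / (q - q⁻¹); 0, 0]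

/-- `π_{ν₁,ν₂}(X⁻)`. -/
def piXm : Matrix (Fin 2) (Fin 2) ℂ := !![0, 0; 1, 0]

/-- The block-diagonal matrix with blocks `A`, `B`, indexed by `Fin 2 × Fin 2`
(first component is the block index). -/
def blockDiag2 (A B : Matrix (Fin 2) (Fin 2) ℂ) :
    Matrix (Fin 2 × Fin 2) (Fin 2 × Fin 2) ℂ :=
  fun p r =>
    if p.1 = r.1 then (if p.1 = 0 then A p.2 r.2 else B p.2 r.2) else 0

lemma inv_diag_two {a b : ℂ} (ha : a ≠ 0) (hb : b ≠ 0) :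
    (!![a, 0; 0, b] : Matrix (Fin 2) (Fin 2) ℂ)⁻¹ = !![a⁻¹, 0; 0, b⁻¹] := by
  apply Matrix.inv_eq_right_inv
  ext i j
  fin_cases i <;> fin_cases j <;> simp [ha, hb]

lemma conj_eq_of_mul_eq {n : Type*} [Fintype n] [DecidableEq n] {P Q T B : Matrix n n ℂ}
    (hQP : Q * P = 1) (hT : T * P = P * B) : Q * T * Q⁻¹ = B := by
  rw [Matrix.inv_eq_right_inv hQP, Matrix.mul_assoc, hT, ← Matrix.mul_assoc, hQP, Matrix.one_mul]

/-- The change-of-basis matrix whose columns are `v₀ ⊗ v₀` and its image under `X⁻`, followed by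
the second highest weight vector `a v₀ ⊗ v₁ + b v₁ ⊗ v₀` and its image `c v₁ ⊗ v₁` under `X⁻`. -/
def basisMatrix (s t a b c : ℂ) : Matrix (Fin 2 × Fin 2) (Fin 2 × Fin 2) ℂ :=
  fun p r => !![!![1, 0; 0, s], !![0, 0; a, 0]; !![0, t; 0, 0], !![b, 0; 0, c]] p.1 r.1 p.2 r.2

/-- The inverse of `basisMatrix s t a b c`, where `d = s * b - t * a`. -/
noncomputable def basisMatrixInv (s t a b c d : ℂ) : Matrix (Fin 2 × Fin 2) (Fin 2 × Fin 2) ℂ :=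
  fun p r => !![!![1, 0; 0, b / d], !![0, 0; -a / d, 0];
    !![0, -t / d; 0, 0], !![s / d, 0; 0, c⁻¹]] p.1 r.1 p.2 r.2

lemma basisMatrixInv_mul {s t a b c d : ℂ} (hd : d = s * b - t * a) (hd0 : d ≠ 0) (hc : c ≠ 0) :
    basisMatrixInv s t a b c d * basisMatrix s t a b c = 1 := by
  ext ⟨i, j⟩ ⟨k, l⟩
  fin_cases i <;> fin_cases j <;> fin_cases k <;> fin_cases l <;>
    simp [Matrix.mul_apply, Fintype.sum_prod_type, basisMatrix, basisMatrixInv, hc] <;>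
      field_simp <;> rw [hd] <;> ring

/-- The tensor product of two 2-dimensional irreducible representations of
`U_q(K₁,K₂,X±)` decomposes as
`(λ₁,λ₂)⊗(μ₁,μ₂) = (λ₁μ₁,λ₂μ₂) ⊕ (q⁻¹λ₁μ₁,−qλ₂μ₂)`. -/
theorem tensor_decomposition (q l1 l2 m1 m2 : ℂ) (hq : q ≠ 0) (hq2 : q ^ 2 ≠ 1)
    (hl1 : l1 ≠ 0) (hl2 : l2 ≠ 0) (hm1 : m1 ≠ 0) (hm2 : m2 ≠ 0)
    (h : (l1 * l2 * m1 * m2) ^ 2 ≠ 1) :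
    let TK1 := piK1 q l1 ⊗ₖ piK1 q m1
    let TK2 := piK2 q l2 ⊗ₖ piK2 q m2
    let TXp := piXp q l1 l2 ⊗ₖ piK1 q m1 + (piK2 q l2)⁻¹ ⊗ₖ piXp q m1 m2
    let TXm := piXm ⊗ₖ piK2 q m2 + (piK1 q l1)⁻¹ ⊗ₖ piXm
    ∃ S : Matrix (Fin 2 × Fin 2) (Fin 2 × Fin 2) ℂ, IsUnit S ∧
      S * TK1 * S⁻¹ =
        blockDiag2 (piK1 q (l1 * m1)) (piK1 q (q⁻¹ * l1 * m1)) ∧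
      S * TK2 * S⁻¹ =
        blockDiag2 (piK2 q (l2 * m2)) (piK2 q (-q * l2 * m2)) ∧
      S * TXp * S⁻¹ =
        blockDiag2 (piXp q (l1 * m1) (l2 * m2))
          (piXp q (q⁻¹ * l1 * m1) (-q * l2 * m2)) ∧
      S * TXm * S⁻¹ = blockDiag2 piXm piXm := by
  intro TK1 TK2 TXp TXm
  have hD : l1 * l2 * m1 * m2 - (l1 * l2 * m1 * m2)⁻¹ ≠ 0 :=
    fun e => h (by field_simp at e; linear_combination e)
  obtain ⟨a, ha⟩ : ∃ a, a = m1 * l2 * (l1 * l2 - (l1 * l2)⁻¹) := ⟨_, rfl⟩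
  obtain ⟨b, hb⟩ : ∃ b, b = -(m1 * m2 - (m1 * m2)⁻¹) := ⟨_, rfl⟩
  obtain ⟨d, hd⟩ : ∃ d, d = -l2 * (l1 * l2 * m1 * m2 - (l1 * l2 * m1 * m2)⁻¹) := ⟨_, rfl⟩
  have hd0 : d ≠ 0 := hd ▸ mul_ne_zero (neg_ne_zero.mpr hl2) hD
  have hd' : d = l1⁻¹ * b - m2 * a := by rw [hd, ha, hb]; field_simp; ring
  have hQP := basisMatrixInv_mul hd' hd0 (mul_ne_zero hq hd0)
  have hK1 := inv_diag_two hl1 (mul_ne_zero (inv_ne_zero hq) hl1)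
  have hK2 := inv_diag_two hl2 (neg_ne_zero.mpr (mul_ne_zero hq hl2))
  refine ⟨_, IsUnit.of_mul_eq_one _ hQP, conj_eq_of_mul_eq hQP ?_, conj_eq_of_mul_eq hQP ?_,
    conj_eq_of_mul_eq hQP ?_, conj_eq_of_mul_eq hQP ?_⟩
  all_goals
    ext ⟨i, j⟩ ⟨k, l⟩
    fin_cases i <;> fin_cases j <;> fin_cases k <;> fin_cases l <;>
      simp [TK1, TK2, TXp, TXm, Matrix.mul_apply, Fintype.sum_prod_type, basisMatrix, blockDiag2,
        piK1, piK2, piXp, piXm, hK1, hK2, -mul_eq_mul_left_iff, -mul_eq_mul_right_iff] <;>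
      (try rw [hd]) <;> (try rw [ha]) <;> (try rw [hb]) <;> field_simp <;> ring
end

section
/- Let A be an associative unital ℂ-algebra, q a nonzero complex number, and a, b, c, d ∈ A with a and d invertible, satisfying the relations ba = q·ab, ca = q·ac, db = −q⁻¹·bd, dc = −q⁻¹·cd, cb = bc, da − ad = (q − q⁻¹)·bc, b² = 0, c² = 0. Then in the 2×2 matrix ring over A, the matrix S = [[a⁻¹ + a⁻¹bd⁻¹ca⁻¹, −a⁻¹bd⁻¹],[−d⁻¹ca⁻¹, d⁻¹ + d⁻¹ca⁻¹bd⁻¹]] is a two-sided inverse of t = [[a,b],[c,d]]: t·S = S·t = 1. -/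
theorem invOf_mul_eq_smul_mul_invOf {R A : Type*} [CommSemiring R] [Semiring A] [Algebra R A]
    {r : R} {u x : A} [Invertible u] (h : x * u = r • (u * x)) :
    ⅟u * x = r • (x * ⅟u) :=
  calc ⅟u * x = ⅟u * (x * u) * ⅟u := by simp [mul_assoc]
    _ = r • (x * ⅟u) := by simp [h]

theorem mul_invOf_eq_smul_invOf_mul {R A : Type*} [CommSemiring R] [Semiring A] [Algebra R A]
    {r : R} {u x : A} [Invertible u] (h : u * x = r • (x * u)) :
    x * ⅟u = r • (⅟u * x) :=
  calc x * ⅟u = ⅟u * (u * x) * ⅟u := by simp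
    _ = r • (⅟u * x) := by simp [h, mul_assoc]

/-- For the non-standard quantum matrix bialgebra `A(R)` of the Alexander–Conway
R-matrix, with `a`, `d` invertible, the antipode matrix `S` is a two-sided inverse of
`t = [[a,b],[c,d]]` in the `2×2` matrix ring. -/
theorem AR_antipode {A : Type*} [Ring A] [Algebra ℂ A] (q : ℂ) (hq : q ≠ 0)
    (a b c d : A) [Invertible a] [Invertible d]
    (h1 : b * a = q • (a * b)) (h2 : c * a = q • (a * c))
    (h3 : d * b = (-q⁻¹) • (b * d)) (h4 : d * c = (-q⁻¹) • (c * d))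
    (h5 : c * b = b * c) (h6 : d * a - a * d = (q - q⁻¹) • (b * c))
    (h7 : b * b = 0) (h8 : c * c = 0) :
    let t : Matrix (Fin 2) (Fin 2) A := !![a, b; c, d]
    let S : Matrix (Fin 2) (Fin 2) A :=
      !![⅟a + ⅟a * b * ⅟d * c * ⅟a, -(⅟a * b * ⅟d);
         -(⅟d * c * ⅟a), ⅟d + ⅟d * c * ⅟a * b * ⅟d]
    t * S = 1 ∧ S * t = 1 := by
  have hab := invOf_mul_eq_smul_mul_invOf h1
  have hac := invOf_mul_eq_smul_mul_invOf h2
  have hbd := mul_invOf_eq_smul_invOf_mul h3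
  have hdc : ⅟d * c = (-q) • (c * ⅟d) := by
    rw [mul_invOf_eq_smul_invOf_mul h4, smul_smul, neg_mul_neg, mul_inv_cancel₀ hq, one_smul]
  have hb : b * ⅟d * c * ⅟a * b = 0 := by
    calc b * ⅟d * c * ⅟a * b = b * ⅟d * c * (⅟a * b) := by simp only [mul_assoc]
      _ = (q * -q⁻¹) • (⅟d * (b * (c * b)) * ⅟a) := by
        rw [hab, hbd]
        simp only [mul_smul_comm, smul_mul_assoc, smul_smul, mul_assoc]
      _ = 0 := by rw [h5, ← mul_assoc b b c, h7]; simp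
  have hc : c * ⅟a * b * ⅟d * c = 0 := by
    calc c * ⅟a * b * ⅟d * c = c * (⅟a * b) * (⅟d * c) := by simp only [mul_assoc]
      _ = (-q * q) • (c * b * (⅟a * c) * ⅟d) := by
        rw [hab, hdc]
        simp only [mul_smul_comm, smul_mul_assoc, smul_smul, mul_assoc]
      _ = 0 := by
        rw [hac, h5, mul_smul_comm, ← mul_assoc, mul_assoc b c c, h8]
        simp
  have hbd' : b * ⅟d * c * ⅟a * b * ⅟d = 0 := by rw [hb, zero_mul]
  have hca' : c * ⅟a * b * ⅟d * c * ⅟a = 0 := by rw [hc, zero_mul]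
  intro t S
  constructor <;> ext i j <;> fin_cases i <;> fin_cases j <;>
    simp [t, S, Matrix.mul_apply, Fin.sum_univ_two, mul_add, add_mul]
  all_goals simp only [mul_assoc] at hb hc hbd' hca' ⊢
  all_goals simp [hb, hc, hbd', hca']
end

section
/- Let A be an associative unital ℂ-algebra, q a nonzero complex number, and a, b, c, d ∈ A with a and d invertible, satisfying ba = q·ab, ca = q·ac, db = −q⁻¹·bd, dc = −q⁻¹·cd, cb = bc, da − ad = (q − q⁻¹)·bc, b² = 0, c² = 0. Then the element 𝒟 = a·d⁻¹ − b·d⁻¹·c·d⁻¹ commutes with a and with d, anticommutes with b and with c (𝒟b = −b𝒟 and 𝒟c = −c𝒟), and consequently 𝒟² commutes with each of a, b, c, d. -/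
/-- If `d * x = r • (x * d)` with `d` invertible, then `d⁻¹ * x = r⁻¹ • (x * d⁻¹)`. -/
theorem invOf_mul_eq_smul_of_mul_eq_smul {K A : Type*} [Field K] [Ring A] [Algebra K A]
    {r : K} (hr : r ≠ 0) {d x : A} [Invertible d] (h : d * x = r • (x * d)) :
    ⅟d * x = r⁻¹ • (x * ⅟d) := by
  have hx : x = r • (⅟d * x * d) := by
    rw [mul_assoc, ← mul_smul_comm, ← h, invOf_mul_cancel_left]
  calc ⅟d * x = r⁻¹ • (r • (⅟d * x * d)) * ⅟d := by
        rw [inv_smul_smul₀ hr, mul_invOf_cancel_right]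
    _ = r⁻¹ • (x * ⅟d) := by rw [← hx, smul_mul_assoc]

/-- If `D` anticommutes with `x`, then `D ^ 2` commutes with `x`. -/
theorem sq_mul_eq_mul_sq_of_mul_eq_neg {A : Type*} [Ring A] {D x : A}
    (h : D * x = -(x * D)) : D ^ 2 * x = x * D ^ 2 := by
  rw [sq, mul_assoc, h, mul_neg, ← mul_assoc, h, neg_mul, neg_neg, mul_assoc]

/-- For the non-standard quantum matrix bialgebra `A(R)` of the Alexander–Conway
R-matrix, the quantum-determinant-like element `𝒟 = ad⁻¹ − bd⁻¹cd⁻¹` commutes with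
`a`, `d`, anticommutes with `b`, `c`, and its square commutes with all generators. -/
theorem AR_determinant {A : Type*} [Ring A] [Algebra ℂ A] (q : ℂ) (hq : q ≠ 0)
    (a b c d : A) [Invertible a] [Invertible d]
    (h1 : b * a = q • (a * b)) (h2 : c * a = q • (a * c))
    (h3 : d * b = (-q⁻¹) • (b * d)) (h4 : d * c = (-q⁻¹) • (c * d))
    (h5 : c * b = b * c) (h6 : d * a - a * d = (q - q⁻¹) • (b * c))
    (h7 : b * b = 0) (h8 : c * c = 0) :
    let D : A := a * ⅟d - b * ⅟d * c * ⅟d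
    D * a = a * D ∧ D * d = d * D ∧ D * b = -(b * D) ∧ D * c = -(c * D) ∧
      D ^ 2 * a = a * D ^ 2 ∧ D ^ 2 * b = b * D ^ 2 ∧
      D ^ 2 * c = c * D ^ 2 ∧ D ^ 2 * d = d * D ^ 2 := by
  intro D
  have hq' : -q⁻¹ ≠ 0 := neg_ne_zero.2 (inv_ne_zero hq)
  have eb : ⅟d * b = (-q) • (b * ⅟d) := by
    simpa [inv_neg] using invOf_mul_eq_smul_of_mul_eq_smul hq' h3
  have ec : ⅟d * c = (-q) • (c * ⅟d) := by
    simpa [inv_neg] using invOf_mul_eq_smul_of_mul_eq_smul hq' h4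
  have assoc_rule {x y z : A} (h : x * y = z) (w : A) : x * (y * w) = z * w := by
    rw [← mul_assoc, h]
  have hD : D = a * ⅟d + q • (b * (c * (⅟d * ⅟d))) := by
    simp only [D, mul_assoc, assoc_rule ec, smul_mul_assoc, mul_smul_comm, neg_smul,
      mul_neg, neg_mul, sub_neg_eq_add]
  have h6' : d * a = a * d + (q - q⁻¹) • (b * c) := by rw [← h6]; abel
  have ea : ⅟d * a = a * ⅟d - ((q - q⁻¹) * q ^ 2) • (b * (c * (⅟d * ⅟d))) := by
    have h : ⅟d * (d * a) * ⅟d = ⅟d * (a * d + (q - q⁻¹) • (b * c)) * ⅟d := by rw [h6']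
    rw [invOf_mul_cancel_left] at h
    rw [h]
    simp only [mul_add, add_mul, mul_assoc, mul_invOf_self, mul_one, smul_mul_assoc,
      mul_smul_comm, assoc_rule eb, assoc_rule ec, smul_smul]
    module
  have ha : D * a = a * D := by
    rw [hD]
    simp only [mul_add, add_mul, mul_sub, mul_assoc, smul_mul_assoc, mul_smul_comm, ea,
      assoc_rule ea, assoc_rule eb, assoc_rule ec, sub_mul, assoc_rule h1, assoc_rule h2,
      assoc_rule h5, assoc_rule h8, zero_mul, mul_zero, smul_zero, smul_smul,
      sub_zero]
    match_scalars <;> field_simp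
    ring
  have hd : D * d = d * D := by
    rw [hD]
    simp only [mul_add, add_mul, mul_assoc, smul_mul_assoc, mul_smul_comm, assoc_rule h6',
      assoc_rule h3, assoc_rule h4, invOf_mul_self, mul_invOf_self, mul_invOf_cancel_left,
      mul_one, smul_smul]
    match_scalars <;> field_simp
    ring
  have hb : D * b = -(b * D) := by
    rw [hD]
    simp only [mul_add, add_mul, mul_assoc, smul_mul_assoc, mul_smul_comm, eb, assoc_rule eb,
      assoc_rule h1, assoc_rule h5, assoc_rule h7, zero_mul, smul_zero, add_zero,
      neg_smul, mul_neg, neg_mul, neg_zero]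
  have hc : D * c = -(c * D) := by
    rw [hD]
    simp only [mul_add, add_mul, mul_assoc, smul_mul_assoc, mul_smul_comm, ec, assoc_rule ec,
      assoc_rule h2, assoc_rule h5, assoc_rule h8, zero_mul, mul_zero, smul_zero, add_zero,
      neg_smul, mul_neg, neg_mul, neg_zero]
  exact ⟨ha, hd, hb, hc, (Commute.pow_left ha 2).eq, sq_mul_eq_mul_sq_of_mul_eq_neg hb,
    sq_mul_eq_mul_sq_of_mul_eq_neg hc, (Commute.pow_left hd 2).eq⟩
end

section
/- Let A be an associative unital ℂ-algebra, q a nonzero complex number, and let a,b,c,d ∈ A and a',b',c',d' ∈ A be two quadruples, each satisfying the relations ba = qab, ca = qac, db = −q⁻¹bd, dc = −q⁻¹cd, cb = bc, da − ad = (q−q⁻¹)bc, b² = c² = 0 (and likewise for the primed quadruple), such that each of a,b,c,d commutes with each of a',b',c',d'. Assume a, d, a', d' are invertible, and also that the product-matrix entries a'' = aa' + bc' and d'' = cb' + dd' are invertible. Writing 𝒟(x,y,z,w) = x·w⁻¹ − y·w⁻¹·z·w⁻¹ and letting [[a'',b''],[c'',d'']] = [[a,b],[c,d]]·[[a',b'],[c',d']],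 one has 𝒟(a'',b'',c'',d'') = 𝒟(a,b,c,d)·𝒟(a',b',c',d'). -/
/-- A rewriting rule `x * y = s • (u * v)` also applies inside right-nested products. -/
theorem mul_mul_eq_smul_of_mul_eq_smul {A : Type*} [Ring A] [Algebra ℂ A]
    {s : ℂ} {x y u v : A} (h : x * y = s • (u * v)) (z : A) :
    x * (y * z) = s • (u * (v * z)) := by
  rw [← mul_assoc, h, smul_mul_assoc, mul_assoc]

/-- If `d` and `b` commute up to a scalar `-q⁻¹`, then `⅟d` and `b` commute up to `-q`. -/
theorem invOf_mul_eq_neg_smul {A : Type*} [Ring A] [Algebra ℂ A] {q : ℂ} (hq : q ≠ 0)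
    {b d : A} [Invertible d] (h : d * b = (-q⁻¹) • (b * d)) :
    ⅟d * b = (-q) • (b * ⅟d) := by
  have hb : b * d = (-q) • (d * b) := by
    rw [h, smul_smul]
    simp [hq]
  calc ⅟d * b = ⅟d * (b * d) * ⅟d := by simp [mul_assoc]
    _ = (-q) • (b * ⅟d) := by rw [hb]; simp

/-- Multiplicativity `𝒟(t·t') = 𝒟(t)𝒟(t')` of the quantum-determinant-like element
of the non-standard quantum matrix bialgebra `A(R)` of the Alexander–Conway R-matrix,
for two commuting quantum matrices `t`, `t'`. -/
theorem AR_determinant_multiplicative {A : Type*} [Ring A] [Algebra ℂ A]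
    (q : ℂ) (hq : q ≠ 0) (a b c d a' b' c' d' : A)
    (h1 : b * a = q • (a * b)) (h2 : c * a = q • (a * c))
    (h3 : d * b = (-q⁻¹) • (b * d)) (h4 : d * c = (-q⁻¹) • (c * d))
    (h5 : c * b = b * c) (h6 : d * a - a * d = (q - q⁻¹) • (b * c))
    (h7 : b * b = 0) (h8 : c * c = 0)
    (h1' : b' * a' = q • (a' * b')) (h2' : c' * a' = q • (a' * c'))
    (h3' : d' * b' = (-q⁻¹) • (b' * d')) (h4' : d' * c' = (-q⁻¹) • (c' * d'))
    (h5' : c' * b' = b' * c') (h6' : d' * a' - a' * d' = (q - q⁻¹) • (b' * c'))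
    (h7' : b' * b' = 0) (h8' : c' * c' = 0)
    (hcomm : ∀ x ∈ ({a, b, c, d} : Set A), ∀ y ∈ ({a', b', c', d'} : Set A),
      x * y = y * x)
    [Invertible a] [Invertible d] [Invertible a'] [Invertible d']
    [Invertible (a * a' + b * c')] [Invertible (c * b' + d * d')] :
    let Ddet : A → A → A → A → A :=
      fun x y z wi => x * wi - y * wi * z * wi
    Ddet (a * a' + b * c') (a * b' + b * d') (c * a' + d * c')
        (⅟(c * b' + d * d')) =
      Ddet a b c (⅟d) * Ddet a' b' c' (⅟d') := by
  intro Ddet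
  have hda' : d' * a' = a' * d' + (q - q⁻¹) • (b' * c') := by rw [← h6']; abel
  have hec := invOf_mul_eq_neg_smul hq h4
  have heb' := invOf_mul_eq_neg_smul hq h3'
  have hec' := invOf_mul_eq_neg_smul hq h4'
  have kac : Commute a' c := (hcomm c (by simp) a' (by simp)).symm
  have kad : Commute a' d := (hcomm d (by simp) a' (by simp)).symm
  have kbc : Commute b' c := (hcomm c (by simp) b' (by simp)).symm
  have kbd : Commute b' d := (hcomm d (by simp) b' (by simp)).symm
  have kcc : Commute c' c := (hcomm c (by simp) c' (by simp)).symm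
  have kcd : Commute c' d := (hcomm d (by simp) c' (by simp)).symm
  have kdc : Commute d' c := (hcomm c (by simp) d' (by simp)).symm
  have kdd : Commute d' d := (hcomm d (by simp) d' (by simp)).symm
  have kec : Commute (⅟d') c := kdc.invOf_left
  have ked : Commute (⅟d') d := kdd.invOf_left
  have g8 (z : A) : c * (c * z) = 0 := by rw [← mul_assoc, h8, zero_mul]
  have g5' (z : A) : c' * (b' * z) = b' * (c' * z) := by rw [← mul_assoc, h5', mul_assoc]
  have g7' (z : A) : b' * (b' * z) = 0 := by rw [← mul_assoc, h7', zero_mul]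
  have hcd : (c * a' + d * c') * (c * b' + d * d') =
      (-q) • ((c * b' + d * d') * (c * a' + d * c')) := by
    simp only [mul_add, add_mul, mul_assoc, mul_smul_comm, kac.left_comm, kad.left_comm,
      kbc.left_comm, kbd.left_comm, kcc.left_comm, kcd.left_comm, kdc.left_comm, kdd.left_comm,
      mul_mul_eq_smul_of_mul_eq_smul h4, g8, h1', h4', h5', hda', smul_zero, zero_add, smul_add]
    match_scalars <;> field_simp <;> ring
  have hdet : (a * a' + b * c') * (c * b' + d * d') +
        q • ((a * b' + b * d') * (c * a' + d * c')) =
      (a * ⅟d - b * ⅟d * c * ⅟d) * (a' * ⅟d' - b' * ⅟d' * c' * ⅟d') *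
        ((c * b' + d * d') * (c * b' + d * d')) := by
    simp only [mul_add, add_mul, mul_sub, sub_mul, mul_assoc, smul_mul_assoc, mul_smul_comm,
      kac.left_comm, kad.left_comm, kbc.left_comm, kbd.left_comm, kcc.left_comm, kcd.eq,
      kcd.left_comm, kdc.left_comm, kdd.left_comm, kec.left_comm, ked.left_comm,
      mul_mul_eq_smul_of_mul_eq_smul h4, hec, mul_mul_eq_smul_of_mul_eq_smul hec, g8, h1', h3',
      h4', heb', mul_mul_eq_smul_of_mul_eq_smul heb', hec', h5', g5', hda', h7', g7',
      invOf_mul_self, invOf_mul_cancel_left, mul_one, mul_zero, smul_zero, zero_add, sub_zero,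
      smul_add]
    match_scalars <;> field_simp <;> ring
  have hu : IsUnit ((c * b' + d * d') * (c * b' + d * d')) :=
    (isUnit_of_invertible _).mul (isUnit_of_invertible _)
  refine hu.mul_right_cancel ?_
  refine Eq.trans ?_ hdet
  generalize c * b' + d * d' = w at *
  simp only [Ddet, sub_mul, mul_assoc, invOf_mul_cancel_left, hcd, mul_smul_comm]
  rw [neg_smul, sub_neg_eq_add]
end

section
/- Let A be an associative unital ℂ-algebra and q ∈ ℂ with q ≠ 0 and q² ≠ 1. Let K₁, K₂ ∈ A be invertible and commute with each other, and let X⁺, X⁻ ∈ A satisfy K₁X± = q^{±1}X±K₁, K₂X± = −q^{∓1}X±K₂, X⁺X⁻ − X⁻X⁺ = (K₁K₂ − K₁⁻¹K₂⁻¹)/(q − q⁻¹), and (X⁺)² = (X⁻)² = 0. Then: (i) K₁K₂ anticommutes with X⁺ and with X⁻; (ii) (K₁K₂)² commutes with each of K₁, K₂, X⁺, X⁻; (iii) the Casimir element c₂ = X⁺X⁻ − (1/2)(K₁K₂ − K₁⁻¹K₂⁻¹)/(q − q⁻¹) commutes with each of K₁, K₂, X⁺, X⁻. -/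
theorem anticomm_of_mul_eq_one {A : Type*} [Ring A] {P Q X : A}
    (hPQ : P * Q = 1) (hQP : Q * P = 1) (h : P * X = -(X * P)) : Q * X = -(X * Q) := by
  calc Q * X = Q * (X * P) * Q := by simp only [mul_assoc, hPQ, mul_one]
    _ = -(Q * P * X * Q) := by
      rw [← neg_eq_iff_eq_neg.mpr h]; simp only [mul_assoc, mul_neg, neg_mul]
    _ = -(X * Q) := by rw [hQP, one_mul]

theorem sq_commute_of_anticomm {A : Type*} [Ring A] {P X : A}
    (h : P * X = -(X * P)) : P ^ 2 * X = X * P ^ 2 := by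
  rw [pow_two, mul_assoc, h, mul_neg, ← mul_assoc, h, neg_mul, neg_neg, mul_assoc]

theorem mul_mul_anticomm_of_smul {R A : Type*} [CommRing R] [Ring A] [Algebra R A]
    {a b : R} {K L X : A} (hab : a * b = -1)
    (hK : K * X = a • (X * K)) (hL : L * X = b • (X * L)) :
    K * L * X = -(X * (K * L)) := by
  rw [mul_assoc, hL, mul_smul_comm, ← mul_assoc, hK, smul_mul_assoc, smul_smul, mul_comm b,
    hab, neg_one_smul, mul_assoc]

theorem commute_mul_of_smul {R A : Type*} [CommRing R] [Ring A] [Algebra R A]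
    {a b : R} {K X Y : A} (hab : a * b = 1)
    (hX : K * X = a • (X * K)) (hY : K * Y = b • (Y * K)) : Commute (X * Y) K := by
  symm
  rw [commute_iff_eq, ← mul_assoc, hX, smul_mul_assoc, mul_assoc, hY, mul_smul_comm, smul_smul,
    hab, one_smul, mul_assoc]

/-- In `U_q(K₁,K₂,X±)`: `K₁K₂` anticommutes with `X±`, `(K₁K₂)²` is central on the
generators, and the Casimir `c₂ = X⁺X⁻ − (1/2)(K₁K₂ − K₁⁻¹K₂⁻¹)/(q−q⁻¹)` commutes
with all generators. -/
theorem Uq_casimirs {A : Type*} [Ring A] [Algebra ℂ A] (q : ℂ) (hq : q ≠ 0)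
    (hq2 : q ^ 2 ≠ 1) (K1 K2 Xp Xm : A) [Invertible K1] [Invertible K2]
    (hK : K1 * K2 = K2 * K1)
    (h1p : K1 * Xp = q • (Xp * K1)) (h1m : K1 * Xm = q⁻¹ • (Xm * K1))
    (h2p : K2 * Xp = (-q⁻¹) • (Xp * K2)) (h2m : K2 * Xm = (-q) • (Xm * K2))
    (hcom : Xp * Xm - Xm * Xp = (q - q⁻¹)⁻¹ • (K1 * K2 - ⅟K1 * ⅟K2))
    (hp2 : Xp * Xp = 0) (hm2 : Xm * Xm = 0) :
    let c2 : A := Xp * Xm - ((2 : ℂ)⁻¹ * (q - q⁻¹)⁻¹) • (K1 * K2 - ⅟K1 * ⅟K2)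
    (K1 * K2) * Xp = -(Xp * (K1 * K2)) ∧ (K1 * K2) * Xm = -(Xm * (K1 * K2)) ∧
      (K1 * K2) ^ 2 * K1 = K1 * (K1 * K2) ^ 2 ∧
      (K1 * K2) ^ 2 * K2 = K2 * (K1 * K2) ^ 2 ∧
      (K1 * K2) ^ 2 * Xp = Xp * (K1 * K2) ^ 2 ∧
      (K1 * K2) ^ 2 * Xm = Xm * (K1 * K2) ^ 2 ∧
      c2 * K1 = K1 * c2 ∧ c2 * K2 = K2 * c2 ∧
      c2 * Xp = Xp * c2 ∧ c2 * Xm = Xm * c2 := by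
  intro c2
  have hp : K1 * K2 * Xp = -(Xp * (K1 * K2)) :=
    mul_mul_anticomm_of_smul (by field_simp) h1p h2p
  have hm : K1 * K2 * Xm = -(Xm * (K1 * K2)) :=
    mul_mul_anticomm_of_smul (by field_simp) h1m h2m
  have hPQ : K1 * K2 * (⅟K1 * ⅟K2) = 1 := by
    rw [hK, mul_assoc, mul_invOf_cancel_left, mul_invOf_self]
  have hQP : ⅟K1 * ⅟K2 * (K1 * K2) = 1 := by
    rw [hK, mul_assoc, invOf_mul_cancel_left, invOf_mul_self]
  have hC : Commute K1 K2 := hK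
  have hP1 : Commute (K1 * K2) K1 := (Commute.refl K1).mul_left hC.symm
  have hP2 : Commute (K1 * K2) K2 := hC.mul_left (Commute.refl K2)
  have hQ1 : Commute (⅟K1 * ⅟K2) K1 :=
    (Commute.refl K1).invOf_left.mul_left hC.symm.invOf_left
  have hQ2 : Commute (⅟K1 * ⅟K2) K2 :=
    hC.invOf_left.mul_left (Commute.refl K2).invOf_left
  have hQp := anticomm_of_mul_eq_one hPQ hQP hp
  have hQm := anticomm_of_mul_eq_one hPQ hQP hm
  have hc2 : c2 = Xp * Xm - (2 : ℂ)⁻¹ • (Xp * Xm - Xm * Xp) := by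
    rw [hcom, smul_smul]
  have hEp : (Xp * Xm - Xm * Xp) * Xp = -(Xp * (Xp * Xm - Xm * Xp)) := by
    rw [hcom, smul_mul_assoc, mul_smul_comm, sub_mul, mul_sub, hp, hQp, ← smul_neg]
    congr 1
    abel
  have hEm : (Xp * Xm - Xm * Xp) * Xm = -(Xm * (Xp * Xm - Xm * Xp)) := by
    rw [hcom, smul_mul_assoc, mul_smul_comm, sub_mul, mul_sub, hm, hQm, ← smul_neg]
    congr 1
    abel
  have hX1 : Commute (Xp * Xm) K1 := commute_mul_of_smul (by field_simp) h1p h1m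
  have hX2 : Commute (Xp * Xm) K2 := commute_mul_of_smul (by field_simp) h2p h2m
  refine ⟨hp, hm, hP1.pow_left 2, hP2.pow_left 2, sq_commute_of_anticomm hp,
    sq_commute_of_anticomm hm, hX1.sub_left ((hP1.sub_left hQ1).smul_left _),
    hX2.sub_left ((hP2.sub_left hQ2).smul_left _), ?_, ?_⟩
  · have h1 : Xp * (Xp * Xm) = 0 := by rw [← mul_assoc, hp2, zero_mul]
    have h2 : Xm * Xp * Xp = 0 := by rw [mul_assoc, hp2, mul_zero]
    simp only [hc2, sub_mul, mul_sub, smul_mul_assoc, mul_smul_comm, h1, h2, mul_assoc]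
    module
  · have h1 : Xm * (Xm * Xp) = 0 := by rw [← mul_assoc, hm2, zero_mul]
    have h2 : Xp * Xm * Xm = 0 := by rw [mul_assoc, hm2, mul_zero]
    simp only [hc2, sub_mul, mul_sub, smul_mul_assoc, mul_smul_comm, h1, h2, mul_assoc]
    module
end

section
/- Let A be an associative unital ℂ-algebra, q a nonzero complex number, and α, β, γ, δ ∈ A with α and δ invertible, satisfying the GL_q(1|1) relations βα = q·αβ, γα = q·αγ, δβ = q⁻¹·βδ, δγ = q⁻¹·γδ, γβ = −βγ, δα − αδ = (q − q⁻¹)·βγ, β² = 0, γ² = 0. Then in the 2×2 matrix ring over A, the matrix S = [[α⁻¹ + α⁻¹βδ⁻¹γα⁻¹, −α⁻¹βδ⁻¹],[−δ⁻¹γα⁻¹, δ⁻¹ + δ⁻¹γα⁻¹βδ⁻¹]] is a two-sided inverse of u = [[α,β],[γ,δ]]: u·S = S·u = 1. -/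
/-- Left multiplication by `⅟x` moves past an element that `q`-commutes with `x`. -/
theorem invOf_mul_of_qCommute {A : Type*} [Ring A] [Algebra ℂ A] {q : ℂ} {x y : A} [Invertible x]
    (h : y * x = q • (x * y)) : ⅟x * y = q • (y * ⅟x) := by
  calc ⅟x * y = ⅟x * (y * x) * ⅟x := by simp [mul_assoc]
    _ = q • (y * ⅟x) := by rw [h]; simp

/-- If `b` and `c` `q`-commute with `x`, `b` `q`-commutes with `y`, and `b c b = 0`,
then `b ⅟x c ⅟y b = 0`. -/
theorem mul_invOf_mul_invOf_mul_eq_zero {A : Type*} [Ring A] [Algebra ℂ A] {q : ℂ} {x y b c : A}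
    [Invertible x] [Invertible y] (hbx : b * x = q • (x * b)) (hcx : c * x = q • (x * c))
    (hby : b * y = q • (y * b)) (hbcb : b * c * b = 0) :
    b * ⅟x * c * ⅟y * b = 0 := by
  calc b * ⅟x * c * ⅟y * b = b * (⅟x * c) * (⅟y * b) := by simp only [mul_assoc]
    _ = (q * q) • (b * c * (⅟x * b) * ⅟y) := by
        rw [invOf_mul_of_qCommute hcx, invOf_mul_of_qCommute hby]
        simp only [mul_smul_comm, smul_mul_assoc, smul_smul, mul_assoc]
    _ = (q * q * q) • (b * c * b * ⅟x * ⅟y) := by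
        rw [invOf_mul_of_qCommute hbx]
        simp only [mul_smul_comm, smul_mul_assoc, smul_smul, mul_assoc]
    _ = 0 := by simp [hbcb]


/-- For the super-quantum group `GL_q(1|1)`, with `α`, `δ` invertible, the
super-antipode matrix `S` is a two-sided inverse of `u = [[α,β],[γ,δ]]`. -/
theorem GLq11_antipode {A : Type*} [Ring A] [Algebra ℂ A] (q : ℂ) (hq : q ≠ 0)
    (α β γ δ : A) [Invertible α] [Invertible δ]
    (h1 : β * α = q • (α * β)) (h2 : γ * α = q • (α * γ))
    (h3 : δ * β = q⁻¹ • (β * δ)) (h4 : δ * γ = q⁻¹ • (γ * δ))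
    (h5 : γ * β = -(β * γ)) (h6 : δ * α - α * δ = (q - q⁻¹) • (β * γ))
    (h7 : β * β = 0) (h8 : γ * γ = 0) :
    let u : Matrix (Fin 2) (Fin 2) A := !![α, β; γ, δ]
    let S : Matrix (Fin 2) (Fin 2) A :=
      !![⅟α + ⅟α * β * ⅟δ * γ * ⅟α, -(⅟α * β * ⅟δ);
         -(⅟δ * γ * ⅟α), ⅟δ + ⅟δ * γ * ⅟α * β * ⅟δ]
    u * S = 1 ∧ S * u = 1 := by
  have hβδ : β * δ = q • (δ * β) := by rw [h3, smul_inv_smul₀ hq]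
  have hγδ : γ * δ = q • (δ * γ) := by rw [h4, smul_inv_smul₀ hq]
  have hβγβ : β * γ * β = 0 := by rw [mul_assoc, h5, mul_neg, ← mul_assoc, h7, zero_mul, neg_zero]
  have hγβγ : γ * β * γ = 0 := by rw [h5, neg_mul, mul_assoc, h8, mul_zero, neg_zero]
  have hβ : β * ⅟δ * γ * ⅟α * β = 0 := mul_invOf_mul_invOf_mul_eq_zero hβδ hγδ h1 hβγβ
  have hγ : γ * ⅟α * β * ⅟δ * γ = 0 := mul_invOf_mul_invOf_mul_eq_zero h2 h1 hγδ hγβγ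
  simp only [mul_assoc] at hβ hγ
  have hβ' (z : A) : β * (⅟δ * (γ * (⅟α * (β * z)))) = 0 := by
    simpa [mul_assoc] using congrArg (· * z) hβ
  have hγ' (z : A) : γ * (⅟α * (β * (⅟δ * (γ * z)))) = 0 := by
    simpa [mul_assoc] using congrArg (· * z) hγ
  constructor <;> ext i j <;> fin_cases i <;> fin_cases j <;>
    simp [Matrix.mul_apply, Fin.sum_univ_two, mul_add, add_mul, mul_assoc, hβ, hγ, hβ', hγ']
end

section
/- Let A be an associative unital ℂ-algebra, q a nonzero complex number, and α, β, γ, δ ∈ A with α and δ invertible, satisfying the GL_q^Ω(1|1) relations βα = αβ, γα = q²·αγ, δβ = βδ, δγ = q⁻²·γδ, γβ = −q²·βγ, δα − αδ = (1 − q²)·βγ, β² = 0, γ² = 0. Then the super determinant D = α·δ⁻¹ − β·δ⁻¹·γ·δ⁻¹ commutes with each of α, β, γ, δ. -/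
/-- For the twisted super-quantum group `GL_q^Ω(1|1)`, the super determinant
`D = αδ⁻¹ − βδ⁻¹γδ⁻¹` commutes with each of the generators `α`, `β`, `γ`, `δ`. -/
theorem GLqOmega11_superdet_central {A : Type*} [Ring A] [Algebra ℂ A] (q : ℂ)
    (hq : q ≠ 0) (α β γ δ : A) [Invertible α] [Invertible δ]
    (h1 : β * α = α * β) (h2 : γ * α = (q ^ 2) • (α * γ))
    (h3 : δ * β = β * δ) (h4 : δ * γ = (q ^ 2)⁻¹ • (γ * δ))
    (h5 : γ * β = (-q ^ 2) • (β * γ)) (h6 : δ * α - α * δ = (1 - q ^ 2) • (β * γ))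
    (h7 : β * β = 0) (h8 : γ * γ = 0) :
    let D : A := α * ⅟δ - β * ⅟δ * γ * ⅟δ
    D * α = α * D ∧ D * β = β * D ∧ D * γ = γ * D ∧ D * δ = δ * D := by
  intro D
  have reassoc {x y z : A} (h : x * y = z) (w : A) : x * (y * w) = z * w := by
    rw [← mul_assoc, h]
  have hp : q ^ 2 ≠ 0 := pow_ne_zero 2 hq
  have hD : D = α * ⅟δ - β * ⅟δ * γ * ⅟δ := rfl
  clear_value D
  have hδ : δ * ⅟δ = 1 := mul_invOf_self δ
  have hδ' : ⅟δ * δ = 1 := invOf_mul_self δ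
  generalize ⅟δ = d at *
  generalize q ^ 2 = p at *
  have hdβ : d * β = β * d := by
    calc d * β = d * (β * δ) * d := by simp only [mul_assoc, hδ, mul_one]
      _ = β * d := by rw [← h3, ← mul_assoc, hδ', one_mul]
  have hdγ : d * γ = p • (γ * d) := by
    have hγδ : γ * δ = p • (δ * γ) := by rw [h4, smul_inv_smul₀ hp]
    calc d * γ = d * (γ * δ) * d := by simp only [mul_assoc, hδ, mul_one]
      _ = p • (γ * d) := by
        rw [hγδ, mul_smul_comm, ← mul_assoc, hδ', one_mul, smul_mul_assoc]
  have hdα : d * α = α * d - ((1 - p) * p) • (β * (γ * (d * d))) := by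
    have hδα : α * δ = δ * α - (1 - p) • (β * γ) := by rw [← h6]; abel
    calc d * α = d * (α * δ) * d := by simp only [mul_assoc, hδ, mul_one]
      _ = α * d - (1 - p) • (d * (β * γ) * d) := by
        rw [hδα, mul_sub, ← mul_assoc, hδ', one_mul, sub_mul, mul_smul_comm,
          smul_mul_assoc]
      _ = α * d - ((1 - p) * p) • (β * (γ * (d * d))) := by
        rw [← mul_assoc d, hdβ, mul_assoc β, hdγ]
        simp only [mul_smul_comm, smul_mul_assoc, smul_smul, mul_assoc]
  have hδα : δ * α = α * δ + (1 - p) • (β * γ) := by rw [← h6]; abel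
  have hD' : D = α * d - p • (β * (γ * (d * d))) := by
    rw [hD, mul_assoc β, hdγ]
    simp only [mul_smul_comm, smul_mul_assoc, mul_assoc]
  rw [hD']
  refine ⟨?_, ?_, ?_, ?_⟩ <;>
  · simp only [mul_assoc, mul_sub, sub_mul, add_mul, smul_mul_assoc, mul_smul_comm, smul_smul,
      smul_zero, mul_zero, zero_mul, mul_one, one_mul, sub_zero, reassoc h1, reassoc h2,
      reassoc h3, reassoc h4, reassoc h5, reassoc h7, reassoc h8, hδ, reassoc hδ, hδ',
      hdα, reassoc hdα, hdβ, reassoc hdβ, hdγ, reassoc hdγ, reassoc hδα, mul_inv_cancel₀ hp]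
    try module
end

section
/- Let A be an associative unital ℂ-algebra, q a nonzero complex number, and α, β, γ, δ ∈ A with α and δ invertible, satisfying the GL_q^Ω(1|1) relations βα = αβ, γα = q²·αγ, δβ = βδ, δγ = q⁻²·γδ, γβ = −q²·βγ, δα − αδ = (1 − q²)·βγ, β² = 0, γ² = 0. Then in the 2×2 matrix ring over A, the matrix S = [[α⁻¹ + α⁻¹βδ⁻¹γα⁻¹, −α⁻¹βδ⁻¹],[−δ⁻¹γα⁻¹, δ⁻¹ + δ⁻¹γα⁻¹βδ⁻¹]] is a two-sided inverse of u = [[α,β],[γ,δ]]: u·S = S·u = 1. -/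
/-- A relation `x * a = c • (a * x)` with `a` invertible passes to the inverse of `a`. -/
theorem invOf_mul_eq_smul_of_mul_eq_smul_s15 {R A : Type*} [CommSemiring R] [Semiring A] [Algebra R A]
    {c : R} {a x : A} [Invertible a] (h : x * a = c • (a * x)) :
    ⅟a * x = c • (x * ⅟a) := by
  calc ⅟a * x = ⅟a * (x * a) * ⅟a := by simp only [mul_assoc, mul_invOf_self, mul_one]
    _ = c • (x * ⅟a) := by
      rw [h, mul_smul_comm, smul_mul_assoc, invOf_mul_cancel_left]

/-- For the twisted super-quantum group `GL_q^Ω(1|1)`, with `α`, `δ` invertible, the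
super-antipode matrix `S` is a two-sided inverse of `u = [[α,β],[γ,δ]]`. -/
theorem GLqOmega11_antipode {A : Type*} [Ring A] [Algebra ℂ A] (q : ℂ)
    (hq : q ≠ 0) (α β γ δ : A) [Invertible α] [Invertible δ]
    (h1 : β * α = α * β) (h2 : γ * α = (q ^ 2) • (α * γ))
    (h3 : δ * β = β * δ) (h4 : δ * γ = (q ^ 2)⁻¹ • (γ * δ))
    (h5 : γ * β = (-q ^ 2) • (β * γ)) (h6 : δ * α - α * δ = (1 - q ^ 2) • (β * γ))
    (h7 : β * β = 0) (h8 : γ * γ = 0) :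
    let u : Matrix (Fin 2) (Fin 2) A := !![α, β; γ, δ]
    let S : Matrix (Fin 2) (Fin 2) A :=
      !![⅟α + ⅟α * β * ⅟δ * γ * ⅟α, -(⅟α * β * ⅟δ);
         -(⅟δ * γ * ⅟α), ⅟δ + ⅟δ * γ * ⅟α * β * ⅟δ]
    u * S = 1 ∧ S * u = 1 := by
  have hαβ : ⅟α * β = β * ⅟α := (Commute.invOf_left (show Commute α β from h1.symm)).eq
  have hδβ : ⅟δ * β = β * ⅟δ := (Commute.invOf_left (show Commute δ β from h3)).eq
  have hαγ : ⅟α * γ = (q ^ 2) • (γ * ⅟α) := invOf_mul_eq_smul_of_mul_eq_smul_s15 h2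
  have hδγ : ⅟δ * γ = (q ^ 2) • (γ * ⅟δ) := by
    apply invOf_mul_eq_smul_of_mul_eq_smul_s15
    rw [h4, smul_inv_smul₀ (pow_ne_zero 2 hq)]
  have hβγβ : β * γ * β = 0 := by
    rw [mul_assoc, h5, mul_smul_comm, ← mul_assoc, h7, zero_mul, smul_zero]
  have hβ : β * ⅟δ * γ * ⅟α * β = 0 := by
    calc β * ⅟δ * γ * ⅟α * β = ⅟δ * (β * γ * β) * ⅟α := by
          rw [mul_assoc _ (⅟α) β, hαβ, ← hδβ]
          simp only [mul_assoc]
      _ = 0 := by rw [hβγβ, mul_zero, zero_mul]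
  have hγ : γ * ⅟α * β * ⅟δ * γ = 0 := by
    calc γ * ⅟α * β * ⅟δ * γ = γ * β * (⅟α * (⅟δ * γ)) := by
          rw [mul_assoc γ, hαβ]
          simp only [mul_assoc]
      _ = (q ^ 2 * (q ^ 2 * -q ^ 2)) • (β * (γ * γ) * ⅟α * ⅟δ) := by
          rw [hδγ, mul_smul_comm, ← mul_assoc (⅟α), hαγ, h5]
          simp only [smul_mul_assoc, mul_smul_comm, smul_smul, mul_assoc]
      _ = 0 := by rw [h8, mul_zero, zero_mul, zero_mul, smul_zero]
  simp only [mul_assoc] at hβ hγ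
  have hβδ : β * (⅟δ * (γ * (⅟α * (β * ⅟δ)))) = 0 := by
    simpa only [mul_assoc, zero_mul] using congrArg (· * ⅟δ) hβ
  have hγα : γ * (⅟α * (β * (⅟δ * (γ * ⅟α)))) = 0 := by
    simpa only [mul_assoc, zero_mul] using congrArg (· * ⅟α) hγ
  constructor <;> ext i j <;> fin_cases i <;> fin_cases j <;>
    simp [Matrix.mul_apply, Fin.sum_univ_two, mul_add, add_mul, mul_assoc, hβ, hγ, hβδ, hγα]
end

section
/- Let n ≥ 1, let q be a nonzero complex number, and let R be a complex matrix with entries R^a_i^b_j indexed by a,b,i,j ∈ {1,…,n} (row (a,b), column (i,j)) satisfying the Hecke identity: for all e,f,i,j, ∑_{k,l} R^f_k^e_l · R^l_i^k_j = (q − q⁻¹)·R^f_i^e_j + δ^f_j·δ^e_i. Let A be an associative unital ℂ-algebra containing elements x₁,…,xₙ, ξ₁,…,ξₙ and α, β, γ, δ such that: (Ω relations) for all i,j: x_i·x_j = q⁻¹·∑_{a,b} x_b·x_a·R^a_i^b_j, ξ_i·x_j = q·∑_{a,b} x_b·ξ_a·R^a_i^b_j, ξ_i·ξ_j = −q·∑_{a,b}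 ξ_b·ξ_a·R^a_i^b_j; (GL_q^Ω(1|1) relations) βα = αβ, γα = q²αγ, δβ = βδ, δγ = q⁻²γδ, γβ = −q²βγ, δα − αδ = (1−q²)βγ, β² = γ² = 0; (statistics) α and δ commute with every x_i and every ξ_i, while β and γ commute with every x_i and anticommute with every ξ_i. Define x'_i = α·x_i + β·ξ_i and ξ'_i = γ·x_i + δ·ξ_i. Then the primed elements satisfy the same Ω relations: x'_i·x'_j = q⁻¹·∑_{a,b} x'_b·x'_a·R^a_i^b_j, ξ'_i·x'_j = q·∑_{a,b} x'_b·ξ'_a·R^a_i^b_j, and ξ'_i·ξ'_j = −q·∑_{a,b} ξ'_b·ξ'_a·R^a_i^b_j. -/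
open BigOperators

section RMatrix

variable {ι A : Type*} [Fintype ι] [Ring A] [Algebra ℂ A]

/-- The action of an R-matrix on `A`-valued two-index tensors (the operator `PR`),
as a left `A`-linear map. -/
def braidOp (R : ι → ι → ι → ι → ℂ) : (ι → ι → A) →ₗ[A] (ι → ι → A) where
  toFun F i j := ∑ a, ∑ b, R a i b j • F b a
  map_add' F G := by
    funext i j
    simp [smul_add, Finset.sum_add_distrib]
  map_smul' c F := by
    funext i j
    simp [Finset.mul_sum]

theorem braidOp_apply (R : ι → ι → ι → ι → ℂ) (F : ι → ι → A) (i j : ι) :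
    braidOp R F i j = ∑ a, ∑ b, R a i b j • F b a := rfl

/-- The quadratic relation of `braidOp` coming from the Hecke condition on `R`. -/
theorem braidOp_braidOp [DecidableEq ι] {q : ℂ} {R : ι → ι → ι → ι → ℂ}
    (hHecke : ∀ e f i j : ι,
      ∑ k, ∑ l, R f k e l * R l i k j =
        (q - q⁻¹) * R f i e j + (if f = j then 1 else 0) * (if e = i then 1 else 0))
    (F : ι → ι → A) :
    braidOp R (braidOp R F) = (q - q⁻¹) • braidOp R F + F := by
  funext i j
  have key : braidOp R (braidOp R F) i j =
      ∑ f, ∑ e, (∑ k, ∑ l, R f k e l * R l i k j) • F e f := by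
    simp only [braidOp_apply, Finset.smul_sum, Finset.sum_smul, smul_smul]
    calc ∑ l, ∑ k, ∑ f, ∑ e, (R l i k j * R f k e l) • F e f
        = ∑ k, ∑ f, ∑ e, ∑ l, (R f k e l * R l i k j) • F e f := by
          rw [Finset.sum_comm]
          refine Finset.sum_congr rfl fun k _ => ?_
          rw [Finset.sum_comm]
          refine Finset.sum_congr rfl fun f _ => ?_
          rw [Finset.sum_comm]
          simp only [mul_comm]
      _ = ∑ f, ∑ e, ∑ k, ∑ l, (R f k e l * R l i k j) • F e f := by
          rw [Finset.sum_comm]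
          exact Finset.sum_congr rfl fun f _ => Finset.sum_comm
  rw [key]
  simp only [hHecke, add_smul, Finset.sum_add_distrib, Pi.add_apply, Pi.smul_apply,
    braidOp_apply, Finset.smul_sum, smul_smul]
  simp [ite_smul]

end RMatrix

/-- The `GL_q^Ω(1|1)` super-transformation `x' = αx + βξ`, `ξ' = γx + δξ` preserves
the relations of the quantum exterior algebra `Ω_q(R)` of any Hecke R-matrix. -/
theorem GLqOmega11_covariance (n : ℕ) (hn : 1 ≤ n) (q : ℂ) (hq : q ≠ 0)
    (R : Fin n → Fin n → Fin n → Fin n → ℂ)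
    (hHecke : ∀ e f i j : Fin n,
      ∑ k, ∑ l, R f k e l * R l i k j =
        (q - q⁻¹) * R f i e j + (if f = j then 1 else 0) * (if e = i then 1 else 0))
    {A : Type*} [Ring A] [Algebra ℂ A] (x ξ : Fin n → A) (α β γ δ : A)
    (hxx : ∀ i j, x i * x j = q⁻¹ • ∑ a, ∑ b, R a i b j • (x b * x a))
    (hξx : ∀ i j, ξ i * x j = q • ∑ a, ∑ b, R a i b j • (x b * ξ a))
    (hξξ : ∀ i j, ξ i * ξ j = (-q) • ∑ a, ∑ b, R a i b j • (ξ b * ξ a))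
    (g1 : β * α = α * β) (g2 : γ * α = (q ^ 2) • (α * γ))
    (g3 : δ * β = β * δ) (g4 : δ * γ = (q ^ 2)⁻¹ • (γ * δ))
    (g5 : γ * β = (-q ^ 2) • (β * γ)) (g6 : δ * α - α * δ = (1 - q ^ 2) • (β * γ))
    (g7 : β * β = 0) (g8 : γ * γ = 0)
    (sαx : ∀ i, α * x i = x i * α) (sαξ : ∀ i, α * ξ i = ξ i * α)
    (sδx : ∀ i, δ * x i = x i * δ) (sδξ : ∀ i, δ * ξ i = ξ i * δ)
    (sβx : ∀ i, β * x i = x i * β) (sβξ : ∀ i, β * ξ i = -(ξ i * β))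
    (sγx : ∀ i, γ * x i = x i * γ) (sγξ : ∀ i, γ * ξ i = -(ξ i * γ)) :
    let x' : Fin n → A := fun i => α * x i + β * ξ i
    let ξ' : Fin n → A := fun i => γ * x i + δ * ξ i
    (∀ i j, x' i * x' j = q⁻¹ • ∑ a, ∑ b, R a i b j • (x' b * x' a)) ∧
      (∀ i j, ξ' i * x' j = q • ∑ a, ∑ b, R a i b j • (x' b * ξ' a)) ∧
      (∀ i j, ξ' i * ξ' j = (-q) • ∑ a, ∑ b, R a i b j • (ξ' b * ξ' a)) := by
  intro x' ξ'
  let T : (Fin n → Fin n → A) →ₗ[A] (Fin n → Fin n → A) := braidOp R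
  let X : Fin n → Fin n → A := fun i j => x i * x j
  let P : Fin n → Fin n → A := fun i j => ξ i * x j
  let Q : Fin n → Fin n → A := fun i j => x i * ξ j
  let Y : Fin n → Fin n → A := fun i j => ξ i * ξ j
  have hX : X = q⁻¹ • T X := funext₂ hxx
  have hP : P = q • T Q := funext₂ hξx
  have hY : Y = (-q) • T Y := funext₂ hξξ
  have tX : T X = q • X := ((eq_inv_smul_iff₀ hq).mp hX).symm
  have tQ : T Q = q⁻¹ • P := by rw [hP, inv_smul_smul₀ hq]
  have tY : T Y = (-q)⁻¹ • Y := (eq_inv_smul_iff₀ (neg_ne_zero.mpr hq)).mpr hY.symm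
  have tP : T P = (q - q⁻¹) • P + q • Q := by
    have hTP : T P = q • T (T Q) := by
      conv_lhs => rw [hP]
      exact T.map_smul_of_tower q (T Q)
    rw [hTP, braidOp_braidOp hHecke Q, smul_add, smul_comm, ← hP]
  have mul_mul_swap {a b u v : A} (h : b * u = u * b) : a * u * (b * v) = a * b * (u * v) := by
    rw [mul_assoc, ← mul_assoc u, ← h]
    simp only [mul_assoc]
  have mul_mul_swap_neg {a b u v : A} (h : b * u = -(u * b)) :
      a * u * (b * v) = -(a * b * (u * v)) := by
    rw [mul_assoc, ← mul_assoc u, ← neg_eq_iff_eq_neg.mpr h]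
    simp only [mul_assoc, neg_mul, mul_neg]
  have hX' : (fun i j => x' i * x' j) = (α * α) • X + (α * β) • (Q + P) := by
    funext i j
    simp only [x', X, P, Q, add_mul, mul_add, Pi.add_apply, Pi.smul_apply, smul_eq_mul,
      mul_mul_swap (sαx i), mul_mul_swap (sαξ i), mul_mul_swap (sβx i),
      mul_mul_swap_neg (sβξ i), g1, g7]
    noncomm_ring
  have hQ' : (fun i j => x' i * ξ' j) =
      (α * γ) • X + (α * δ) • Q - (β * γ) • P + (β * δ) • Y := by
    funext i j
    simp only [x', ξ', X, P, Q, Y, add_mul, mul_add, Pi.add_apply, Pi.sub_apply, Pi.smul_apply,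
      smul_eq_mul, mul_mul_swap (sγx i), mul_mul_swap_neg (sγξ i), mul_mul_swap (sδx i),
      mul_mul_swap (sδξ i)]
    abel
  have hP' : (fun i j => ξ' i * x' j) =
      (γ * α) • X + (γ * β) • Q + (δ * α) • P - (δ * β) • Y := by
    funext i j
    simp only [x', ξ', X, P, Q, Y, add_mul, mul_add, Pi.add_apply, Pi.sub_apply, Pi.smul_apply,
      smul_eq_mul, mul_mul_swap (sαx i), mul_mul_swap (sαξ i), mul_mul_swap (sβx i),
      mul_mul_swap_neg (sβξ i)]
    abel
  have hY' : (fun i j => ξ' i * ξ' j) = (γ * δ) • Q - (δ * γ) • P + (δ * δ) • Y := by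
    funext i j
    simp only [ξ', P, Q, Y, add_mul, mul_add, Pi.add_apply, Pi.sub_apply, Pi.smul_apply,
      smul_eq_mul, mul_mul_swap (sγx i), mul_mul_swap_neg (sγξ i), mul_mul_swap (sδx i),
      mul_mul_swap (sδξ i), g8]
    noncomm_ring
  have g6' : δ * α = α * δ + (1 - q ^ 2) • (β * γ) := by rw [← g6]; abel
  refine ⟨fun i j => ?_, fun i j => ?_, fun i j => ?_⟩
  · change (fun i j => x' i * x' j) i j = (q⁻¹ • T (fun i j => x' i * x' j)) i j
    rw [hX']
    simp only [map_add, map_smul, tX, tQ, tP]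
    simp only [Pi.add_apply, Pi.smul_apply, smul_eq_mul, mul_add, mul_smul_comm]
    match_scalars <;> field_simp
    ring
  · change (fun i j => ξ' i * x' j) i j = (q • T (fun i j => x' i * ξ' j)) i j
    rw [hP', hQ', g2, g3, g5, g6']
    simp only [map_add, map_sub, map_smul, tX, tQ, tP, tY]
    simp only [Pi.add_apply, Pi.sub_apply, Pi.smul_apply, smul_eq_mul, mul_add, add_mul,
      mul_smul_comm, smul_mul_assoc]
    match_scalars <;> field_simp
    ring
  · change (fun i j => ξ' i * ξ' j) i j = ((-q) • T (fun i j => ξ' i * ξ' j)) i j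
    rw [hY', g4]
    simp only [map_add, map_sub, map_smul, tQ, tP, tY]
    simp only [Pi.add_apply, Pi.sub_apply, Pi.smul_apply, smul_eq_mul, mul_add,
      mul_smul_comm, smul_mul_assoc]
    match_scalars <;> field_simp
    ring
end

section
/- Let n, m ≥ 0 with n + m ≥ 1, let q be a nonzero complex number, and define the parity p(i) = 0 for 1 ≤ i ≤ n and p(i) = 1 for n+1 ≤ i ≤ n+m. Define the matrix R_{gl(n|m)} with entries indexed by {1,…,n+m} by R = q·∑_{i≤n} E_{ii}⊗E_{ii} − q⁻¹·∑_{i>n} E_{ii}⊗E_{ii} + ∑_{i≠j} (−1)^{p(i)p(j)} E_{ii}⊗E_{jj} + (q − q⁻¹)·∑_{i<j} E_{ij}⊗E_{ji}, where E_{ij} is the elementary matrix and E_{ij}⊗E_{kl} contributes to the entry R^i_j^k_l (row (i,k), column (j,l)). Then R_{gl(n|m)} satisfies the quantum Yang–Baxter equation: for all indices i,j,a,b,c,d ∈ {1,…,n+m}, ∑_{e,f,k} R^b_e^a_f · R^i_k^f_c · R^k_j^e_d = ∑_{p',r,s} R^i_{p'}^b_r · R^{p'}_j^a_s · R^r_d^s_c.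 -/
open BigOperators

/-- The parity `p(i) = 0` for `i ≤ n` and `p(i) = 1` for `i > n` on `Fin (n+m)`. -/
def pargl (n m : ℕ) (i : Fin (n + m)) : ZMod 2 := if (i : ℕ) < n then 0 else 1

/-- The non-standard R-matrix `R_{gl(n|m)}`: `Rgl n m q a c b d` is the entry
`R^a_c^b_d` (row `(a,b)`, column `(c,d)`) of
`q·∑_{i≤n} E_{ii}⊗E_{ii} − q⁻¹·∑_{i>n} E_{ii}⊗E_{ii} + ∑_{i≠j} (−1)^{p(i)p(j)} E_{ii}⊗E_{jj}
 + (q−q⁻¹)·∑_{i<j} E_{ij}⊗E_{ji}`. -/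
noncomputable def Rgl (n m : ℕ) (q : ℂ) (a c b d : Fin (n + m)) : ℂ :=
  if a = c ∧ b = d ∧ a = b then (if (a : ℕ) < n then q else -q⁻¹)
  else if a = c ∧ b = d then msign (pargl n m a * pargl n m b)
  else if a = d ∧ b = c ∧ (a : ℕ) < (b : ℕ) then q - q⁻¹
  else 0

/-- The coefficient of `E_{aa} ⊗ E_{bb}` in `R_{gl(n|m)}`. -/
noncomputable def RglDiag (n m : ℕ) (q : ℂ) (a b : Fin (n + m)) : ℂ :=
  if a = b then (if (a : ℕ) < n then q else -q⁻¹)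
  else if (a : ℕ) < n ∨ (b : ℕ) < n then 1 else -1

/-- The coefficient of `E_{ab} ⊗ E_{ba}`, `a ≠ b`, in `R_{gl(n|m)}`. -/
noncomputable def RglFlip (n m : ℕ) (q : ℂ) (a b : Fin (n + m)) : ℂ :=
  if a < b then q - q⁻¹ else 0

theorem Rgl_eq_diag_add_flip (n m : ℕ) (q : ℂ) (a c b d : Fin (n + m)) :
    Rgl n m q a c b d =
      RglDiag n m q a b * ((if a = c then 1 else 0) * (if b = d then 1 else 0)) +
        RglFlip n m q a b * ((if a = d then 1 else 0) * (if b = c then 1 else 0)) := by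
  have hsign : msign (pargl n m a * pargl n m b) =
      if (a : ℕ) < n ∨ (b : ℕ) < n then 1 else -1 := by
    unfold msign pargl
    by_cases ha : (a : ℕ) < n <;> by_cases hb : (b : ℕ) < n <;> simp [ha, hb]
  unfold Rgl RglDiag RglFlip
  rw [hsign]
  by_cases hab : a = b
  · subst hab
    by_cases hac : a = c <;> by_cases had : a = d <;> simp [hac, had] <;>
      split_ifs <;> rfl
  · simp only [hab, and_false, if_false, Fin.val_fin_lt]
    by_cases hac : a = c
    · subst hac
      by_cases hbd : b = d
      · subst hbd
        simp [hab, Ne.symm hab]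
      · simp [hbd, Ne.symm hab]
    · by_cases had : a = d
      · subst had
        by_cases hbc : b = c <;> simp [hac, hbc, Ne.symm hab]
      · simp [hac, had]

theorem sum_Rgl_mul (n m : ℕ) (q : ℂ) (a b : Fin (n + m))
    (G : Fin (n + m) → Fin (n + m) → ℂ) :
    ∑ c, ∑ d, Rgl n m q a c b d * G c d =
      RglDiag n m q a b * G a b + RglFlip n m q a b * G b a := by
  simp only [Rgl_eq_diag_add_flip, add_mul, Finset.sum_add_distrib]
  simp

set_option maxHeartbeats 1600000 in
/-- `R_{gl(n|m)}` satisfies the quantum Yang–Baxter equation. -/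
theorem Rgl_qybe (n m : ℕ) (hnm : 1 ≤ n + m) (q : ℂ) (hq : q ≠ 0)
    (i j a b c d : Fin (n + m)) :
    ∑ e, ∑ f, ∑ k, Rgl n m q b e a f * Rgl n m q i k f c * Rgl n m q k j e d =
      ∑ p', ∑ r, ∑ s,
        Rgl n m q i p' b r * Rgl n m q p' j a s * Rgl n m q r d s c := by
  have hl : ∑ e, ∑ f, ∑ k, Rgl n m q b e a f * Rgl n m q i k f c * Rgl n m q k j e d =
      RglDiag n m q b a * ∑ k, Rgl n m q i k a c * Rgl n m q k j b d +
        RglFlip n m q b a * ∑ k, Rgl n m q i k b c * Rgl n m q k j a d := by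
    rw [← sum_Rgl_mul n m q b a fun e f => ∑ k, Rgl n m q i k f c * Rgl n m q k j e d]
    simp only [Finset.mul_sum, mul_assoc]
  have hr : ∑ p', ∑ r, ∑ s,
        Rgl n m q i p' b r * Rgl n m q p' j a s * Rgl n m q r d s c =
      RglDiag n m q i b * ∑ s, Rgl n m q i j a s * Rgl n m q b d s c +
        RglFlip n m q i b * ∑ s, Rgl n m q b j a s * Rgl n m q i d s c := by
    rw [← sum_Rgl_mul n m q i b fun p' r => ∑ s, Rgl n m q p' j a s * Rgl n m q r d s c]
    simp only [Finset.mul_sum, mul_assoc]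
  have hleft (x y z : Fin (n + m)) : ∑ k, Rgl n m q x k y c * Rgl n m q k j z d =
      RglDiag n m q x y * (if y = c then 1 else 0) * Rgl n m q x j z d +
        RglFlip n m q x y * (if x = c then 1 else 0) * Rgl n m q y j z d := by
    simp only [Rgl_eq_diag_add_flip n m q x, add_mul, Finset.sum_add_distrib]
    simp [Rgl_eq_diag_add_flip n m q x]
  have hright (x y z : Fin (n + m)) : ∑ s, Rgl n m q x j y s * Rgl n m q z d s c =
      RglDiag n m q x y * (if x = j then 1 else 0) * Rgl n m q z d y c +
        RglFlip n m q x y * (if y = j then 1 else 0) * Rgl n m q z d x c := by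
    simp only [Rgl_eq_diag_add_flip n m q x, add_mul, Finset.sum_add_distrib]
    simp
  rw [hl, hr, hleft, hleft, hright, hright]
  simp only [Rgl_eq_diag_add_flip]
  generalize hδ : (fun x y : Fin (n + m) => if x = y then (1 : ℂ) else 0) = δ
  have hδ' (x y : Fin (n + m)) : (if x = y then (1 : ℂ) else 0) = δ x y := by rw [← hδ]
  simp only [hδ']
  unfold RglDiag RglFlip
  clear hl hr hleft hright hδ hδ'
  by_cases hi : (i : ℕ) < n <;> by_cases hb : (b : ℕ) < n <;> by_cases ha : (a : ℕ) < n <;>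
    rcases lt_trichotomy i b with h1 | h1 | h1 <;>
    rcases lt_trichotomy b a with h2 | h2 | h2 <;>
    rcases lt_trichotomy i a with h3 | h3 | h3 <;>
    first
    | (exfalso; omega)
    | (subst_vars
       simp only [*, ne_of_lt, ne_of_gt, lt_asymm, lt_irrefl, if_true, if_false, true_or, or_true,
         or_self] <;>
       field_simp <;>
       ring)
end

section
/- Let n, m ≥ 0 with n + m ≥ 1, let q be a nonzero complex number, and define the parity p(i) = 0 for 1 ≤ i ≤ n and p(i) = 1 for n+1 ≤ i ≤ n+m. Define the super R-matrix R̄_{gl(n|m)} with entries indexed by {1,…,n+m} by R̄ = q·∑_{i≤n} E_{ii}⊗E_{ii} + q⁻¹·∑_{i>n} E_{ii}⊗E_{ii} + ∑_{i≠j} E_{ii}⊗E_{jj} + (q − q⁻¹)·∑_{i<j} (−1)^{p(i)p(j)} E_{ij}⊗E_{ji}, where E_{ij} is the elementary matrix and E_{ij}⊗E_{kl} contributes to the entry R̄^i_j^k_l (row (i,k), column (j,l)). Then R̄_{gl(n|m)} satisfies the super Yang–Baxter equation: for all indices i,j,a,b,c,d ∈ {1,…,n+m}, ∑_{e,f,k}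 (−1)^{p(e)(p(f)+p(c))} R̄^b_e^a_f · R̄^i_k^f_c · R̄^k_j^e_d = ∑_{p',r,s} (−1)^{p(r)(p(s)+p(a))} R̄^i_{p'}^b_r · R̄^{p'}_j^a_s · R̄^r_d^s_c. -/
open BigOperators

/-- The super R-matrix `R̄_{gl(n|m)}`: `Rbargl n m q a c b d` is the entry
`R̄^a_c^b_d` (row `(a,b)`, column `(c,d)`) of
`q·∑_{i≤n} E_{ii}⊗E_{ii} + q⁻¹·∑_{i>n} E_{ii}⊗E_{ii} + ∑_{i≠j} E_{ii}⊗E_{jj}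
 + (q−q⁻¹)·∑_{i<j} (−1)^{p(i)p(j)} E_{ij}⊗E_{ji}`. -/
noncomputable def Rbargl (n m : ℕ) (q : ℂ) (a c b d : Fin (n + m)) : ℂ :=
  if a = c ∧ b = d ∧ a = b then (if (a : ℕ) < n then q else q⁻¹)
  else if a = c ∧ b = d then 1
  else if a = d ∧ b = c ∧ (a : ℕ) < (b : ℕ) then
    (q - q⁻¹) * msign (pargl n m a * pargl n m b)
  else 0

/-- The Kronecker delta with complex values. -/
noncomputable def kronecker {N : ℕ} (x y : Fin N) : ℂ := if x = y then 1 else 0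

/-- The coefficient of `E_{aa} ⊗ E_{bb}` in `R̄_{gl(n|m)}`. -/
noncomputable def RbarglDiag (n m : ℕ) (q : ℂ) (a b : Fin (n + m)) : ℂ :=
  if a = b then (if (a : ℕ) < n then q else q⁻¹) else 1

/-- The coefficient of `E_{ab} ⊗ E_{ba}` in the off-diagonal part of `R̄_{gl(n|m)}`. -/
noncomputable def RbarglFlip (n m : ℕ) (q : ℂ) (a b : Fin (n + m)) : ℂ :=
  if a < b then (q - q⁻¹) * msign (pargl n m a * pargl n m b) else 0

theorem sum_kronecker_mul {N : ℕ} (x : Fin N) (F : Fin N → ℂ) :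
    ∑ y, kronecker x y * F y = F x := by
  simp [kronecker]

theorem Rbargl_eq (n m : ℕ) (q : ℂ) (a c b d : Fin (n + m)) :
    Rbargl n m q a c b d = kronecker a c * (kronecker b d * RbarglDiag n m q a b) +
      kronecker b c * (kronecker a d * RbarglFlip n m q a b) := by
  unfold Rbargl kronecker RbarglDiag RbarglFlip
  simp only [Fin.lt_def]
  split_ifs <;> first | (exfalso; omega) | simp

theorem sum_Rbargl_mul (n m : ℕ) (q : ℂ) (a b d : Fin (n + m)) (F : Fin (n + m) → ℂ) :
    ∑ c, Rbargl n m q a c b d * F c =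
      kronecker b d * RbarglDiag n m q a b * F a +
        kronecker a d * RbarglFlip n m q a b * F b := by
  simp only [Rbargl_eq, add_mul, Finset.sum_add_distrib, mul_assoc, sum_kronecker_mul]

theorem sum_Rbargl_mul' (n m : ℕ) (q : ℂ) (a c b : Fin (n + m)) (F : Fin (n + m) → ℂ) :
    ∑ d, Rbargl n m q a c b d * F d =
      kronecker a c * RbarglDiag n m q a b * F b +
        kronecker b c * RbarglFlip n m q a b * F a := by
  have h (d : Fin (n + m)) : Rbargl n m q a c b d * F d =
      kronecker b d * (kronecker a c * RbarglDiag n m q a b * F d) +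
        kronecker a d * (kronecker b c * RbarglFlip n m q a b * F d) := by
    rw [Rbargl_eq]
    ring
  simp only [h, Finset.sum_add_distrib, sum_kronecker_mul]

theorem sum_sum_Rbargl_mul (n m : ℕ) (q : ℂ) (a b : Fin (n + m))
    (F : Fin (n + m) → Fin (n + m) → ℂ) :
    ∑ c, ∑ d, Rbargl n m q a c b d * F c d =
      RbarglDiag n m q a b * F a b + RbarglFlip n m q a b * F b a := by
  simp only [sum_Rbargl_mul', Finset.sum_add_distrib, mul_assoc, sum_kronecker_mul]

/-- `R̄_{gl(n|m)}` satisfies the super Yang–Baxter equation. -/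
theorem Rbargl_sybe (n m : ℕ) (hnm : 1 ≤ n + m) (q : ℂ) (hq : q ≠ 0)
    (i j a b c d : Fin (n + m)) :
    ∑ e, ∑ f, ∑ k, msign (pargl n m e * (pargl n m f + pargl n m c)) *
        (Rbargl n m q b e a f * Rbargl n m q i k f c * Rbargl n m q k j e d) =
      ∑ p', ∑ r, ∑ s, msign (pargl n m r * (pargl n m s + pargl n m a)) *
        (Rbargl n m q i p' b r * Rbargl n m q p' j a s * Rbargl n m q r d s c) := by
  have hl (e f k : Fin (n + m)) : msign (pargl n m e * (pargl n m f + pargl n m c)) *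
        (Rbargl n m q b e a f * Rbargl n m q i k f c * Rbargl n m q k j e d) =
      Rbargl n m q b e a f * (Rbargl n m q i k f c *
        (msign (pargl n m e * (pargl n m f + pargl n m c)) * Rbargl n m q k j e d)) := by ring
  have hr (p' r s : Fin (n + m)) : msign (pargl n m r * (pargl n m s + pargl n m a)) *
        (Rbargl n m q i p' b r * Rbargl n m q p' j a s * Rbargl n m q r d s c) =
      Rbargl n m q i p' b r * (Rbargl n m q p' j a s *
        (msign (pargl n m r * (pargl n m s + pargl n m a)) * Rbargl n m q r d s c)) := by ring
  have hk (e f : Fin (n + m)) : ∑ k, Rbargl n m q i k f c *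
        (msign (pargl n m e * (pargl n m f + pargl n m c)) * Rbargl n m q k j e d) =
      kronecker f c * RbarglDiag n m q i f *
          (msign (pargl n m e * (pargl n m f + pargl n m f)) * Rbargl n m q i j e d) +
        kronecker i c * RbarglFlip n m q i f *
          (msign (pargl n m e * (pargl n m f + pargl n m i)) * Rbargl n m q f j e d) := by
    rw [sum_Rbargl_mul]
    unfold kronecker
    split_ifs with h₁ h₂ h₂ <;> simp [*]
  simp only [hl, hr, ← Finset.mul_sum, hk]
  rw [sum_sum_Rbargl_mul, sum_sum_Rbargl_mul]
  simp only [sum_Rbargl_mul']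
  simp only [Rbargl_eq]
  clear hl hr hk
  unfold RbarglDiag RbarglFlip pargl msign
  by_cases hi : (i : ℕ) < n <;> by_cases ha : (a : ℕ) < n <;> by_cases hb : (b : ℕ) < n <;>
    simp only [hi, ha, hb, if_true, if_false, CharTwo.add_self_eq_zero, mul_zero,
      add_zero, zero_add, mul_one, one_mul, one_ne_zero] <;>
    rcases lt_trichotomy i a with h₁ | h₁ | h₁ <;> rcases lt_trichotomy i b with h₂ | h₂ | h₂ <;>
    rcases lt_trichotomy a b with h₃ | h₃ | h₃ <;>
    first
    | exfalso; omega
    | (try subst h₁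
       try subst h₂
       try subst h₃
       simp only [*, lt_irrefl, not_lt_of_gt, ne_of_lt, ne_of_gt, if_true, if_false, mul_zero,
         zero_mul, add_zero, mul_one, one_mul]
       try field_simp
       try ring)
end
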